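/- arXiv:2307.09265 — 2 statements merged into one kernel-verified Lean document; each statement's English description precedes it below -/
import Mathlib

section
/- Let K be an algebraically closed field and V a K-vector space of dimension n. Fix dimension types 0 < a < n with min(a, n − a) ≤ 2, 0 < b_1 < b_2 < n, and 0 < c_1 < ... < c_ℓ < n for an arbitrary integer ℓ ≥ 1. Then the GL(V)-action on triples (A, B_1 ⊆ B_2, C_1 ⊆ ... ⊆ C_ℓ), where A is a subspace of dimension a, (B_1, B_2) is a partial flag of type (b_1, b_2), and (C_1, ..., C_ℓ) is a partial flag of type (c_1, ..., c_ℓ), has finitely many orbits. -/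
open Module

namespace FinOrb

section
variable {K : Type*} [Field K] {V : Type*} [AddCommGroup V] [Module K V]

lemma stage1_hyper [FiniteDimensional K V] {ι : Type*} [Finite ι] (C : ι → Submodule K V)
    (hC : ∀ i j, C i ≤ C j ∨ C j ≤ C i) (W : Submodule K V) (hW : W ≠ ⊥) :
    ∃ H : Submodule K V, H < W ∧ (∀ i, C i < W → C i ≤ H) ∧
      (∀ H' : Submodule K V, H < H' → H' ≤ W → H' = W) := by
  have hG : ∃ G : Submodule K V, G < W ∧ ∀ i, C i < W → C i ≤ G := by
    by_cases hS : ∃ i, C i < W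
    · obtain ⟨i, hi⟩ := (Set.toFinite {i | C i < W}).exists_maximalFor C _ hS
      refine ⟨C i, hi.1, fun j hj => ?_⟩
      rcases hC j i with h | h
      · exact h
      · exact hi.2 hj h
    · push Not at hS
      exact ⟨⊥, bot_lt_iff_ne_bot.2 hW, fun i hi => absurd hi (hS i)⟩
  obtain ⟨G, hGW, hG⟩ := hG
  obtain ⟨H, ⟨hH1, hH2⟩, hH⟩ := (wellFounded_gt (α := Submodule K V)).has_min
    {H | H < W ∧ G ≤ H} ⟨G, hGW, le_rfl⟩
  refine ⟨H, hH1, fun i hi => (hG i hi).trans hH2, fun H' h1 h2 => ?_⟩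
  by_contra hne
  exact hH H' ⟨lt_of_le_of_ne h2 hne, hH2.trans h1.le⟩ h1

lemma stage1 [FiniteDimensional K V] {ι : Type*} [Finite ι] (C : ι → Submodule K V)
    (hC : ∀ i j, C i ≤ C j ∨ C j ≤ C i) (B : ℕ → Submodule K V) (hB : Monotone B)
    (hB2 : B 2 = ⊤) : ∀ (k : ℕ) (W : Submodule K V), finrank K W = k →
      (∀ i, C i ≤ W ∨ W ≤ C i) →
      ∃ (e : ℕ → V) (lam : ℕ → ℕ), (∀ j, lam j ≤ 2) ∧
        (∀ i, C i ≤ W → ∃ m ≤ k, C i = Submodule.span K (e '' {j | j < m})) ∧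
        ∀ s, B s ⊓ W = Submodule.span K (e '' {j | j < k ∧ lam j ≤ s}) := by
  intro k
  induction k with
  | zero =>
    intro W hW _
    have hW : W = ⊥ := Submodule.finrank_eq_zero.1 hW
    subst hW
    refine ⟨fun _ => 0, fun _ => 0, fun _ => by simp, fun i hi => ⟨0, le_rfl, ?_⟩, fun s => ?_⟩
    · simpa using hi
    · simp
  | succ k ih =>
    intro W hW hCW
    have hWb : W ≠ ⊥ := by
      rintro rfl
      simp at hW
    obtain ⟨H, hHW, hCH, hmax⟩ := stage1_hyper C hC W hWb
    have hex : ∃ s, ¬ (B s ⊓ W ≤ H) := ⟨2, by rw [hB2, top_inf_eq]; exact not_le_of_gt hHW⟩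
    classical
    obtain ⟨s0, hs0, hs0min⟩ : ∃ s0, ¬ (B s0 ⊓ W ≤ H) ∧ ∀ s < s0, B s ⊓ W ≤ H :=
      ⟨Nat.find hex, Nat.find_spec hex, fun s hs => not_not.1 (Nat.find_min hex hs)⟩
    have hs02 : s0 ≤ 2 := by
      by_contra h
      have := hs0min 2 (by omega)
      rw [hB2, top_inf_eq] at this
      exact not_le_of_gt hHW this
    obtain ⟨v, hv, hvH⟩ := SetLike.not_le_iff_exists.1 hs0
    have hsup : Submodule.span K {v} ⊔ H = W := by
      apply hmax
      · refine lt_of_le_of_ne le_sup_right ?_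
        intro h
        apply hvH
        rw [h]
        exact Submodule.mem_sup_left (Submodule.mem_span_singleton_self v)
      · exact sup_le ((Submodule.span_singleton_le_iff_mem _ _).2 hv.2) hHW.le
    have hv0 : v ≠ 0 := by
      rintro rfl
      exact hvH H.zero_mem
    have hHk : finrank K H = k := by
      have h1 := Submodule.finrank_lt_finrank_of_lt hHW
      have h2 := Submodule.finrank_add_le_finrank_add_finrank (Submodule.span K {v}) H
      rw [hsup, finrank_span_singleton hv0] at h2
      omega
    obtain ⟨e, lam, hlam, heC, heB⟩ := ih H hHk (fun i => by
      rcases hCW i with h | h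
      · rcases h.lt_or_eq with h | h
        · exact Or.inl (hCH i h)
        · exact Or.inr (h ▸ hHW.le)
      · exact Or.inr (hHW.le.trans h))
    have himg : ∀ S : Set ℕ, (∀ j ∈ S, j < k) → Function.update e k v '' S = e '' S := by
      intro S hS
      apply Set.image_congr
      intro j hj
      rw [Function.update_of_ne (hS j hj).ne]
    have hBs : ∀ s, B s ⊓ W = Submodule.span K (Function.update e k v ''
        {j | j < k + 1 ∧ Function.update lam k s0 j ≤ s}) := by
      intro s
      by_cases hs : s0 ≤ s
      · have : {j | j < k + 1 ∧ Function.update lam k s0 j ≤ s}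
            = insert k {j | j < k ∧ lam j ≤ s} := by
          ext j
          by_cases hj : j = k
          · subst hj; simp [hs]
          · simp [hj, Function.update_of_ne]
            intro _
            omega
        rw [this, Set.image_insert_eq, himg _ (fun j hj => hj.1), Submodule.span_insert, ← heB,
          Function.update_self, ← hsup, inf_comm, inf_comm (B s) H]
        apply sup_inf_assoc_of_le
        exact (Submodule.span_singleton_le_iff_mem _ _).2 (hB hs hv.1)
      · have : {j | j < k + 1 ∧ Function.update lam k s0 j ≤ s}
            = {j | j < k ∧ lam j ≤ s} := by
          ext j
          by_cases hj : j = k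
          · subst hj; simp; omega
          · simp [hj, Function.update_of_ne]
            intro _
            omega
        rw [this, himg _ (fun j hj => hj.1), ← heB]
        exact le_antisymm (le_inf inf_le_left (hs0min s (by omega))) (inf_le_inf le_rfl hHW.le)
    refine ⟨Function.update e k v, Function.update lam k s0, ?_, ?_, hBs⟩
    · intro j
      by_cases hj : j = k
      · subst hj; simpa using hs02
      · simpa [hj, Function.update_of_ne] using hlam j
    · intro i hi
      rcases hi.lt_or_eq with h | h
      · obtain ⟨m, hm, hCm⟩ := heC i (hCH i h)
        refine ⟨m, by omega, ?_⟩
        rw [himg {j | j < m} (fun j hj => lt_of_lt_of_le hj hm), hCm]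
      · refine ⟨k + 1, le_rfl, ?_⟩
        have := hBs 2
        rw [hB2, top_inf_eq] at this
        rw [h, this]
        congr 2
        ext j
        simp only [Set.mem_ofPred_eq, and_iff_left_iff_imp]
        intro _
        by_cases hj : j = k
        · subst hj; simpa using hs02
        · simpa [hj, Function.update_of_ne] using hlam j

lemma span_tri (e e' : ℕ → V) (lam : ℕ → ℕ)
    (h : ∀ j, ∃ c : K, c ≠ 0 ∧
      e' j - c • e j ∈ Submodule.span K (e '' {i | i < j ∧ lam i = lam j}))
    (S : Set ℕ) (hS : ∀ j ∈ S, ∀ i < j, lam i = lam j → i ∈ S) :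
    Submodule.span K (e' '' S) = Submodule.span K (e '' S) := by
  have hsub : ∀ j ∈ S, e '' {i | i < j ∧ lam i = lam j} ⊆ e '' S := by
    intro j hj
    apply Set.image_mono
    intro i hi
    exact hS j hj i hi.1 hi.2
  apply le_antisymm
  · rw [Submodule.span_le]
    rintro _ ⟨j, hj, rfl⟩
    obtain ⟨c, hc, hm⟩ := h j
    have h1 := Submodule.span_mono (hsub j hj) hm
    have h2 : c • e j ∈ Submodule.span K (e '' S) :=
      Submodule.smul_mem _ _ (Submodule.subset_span ⟨j, hj, rfl⟩)
    simpa using Submodule.add_mem _ h1 h2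
  · rw [Submodule.span_le]
    rintro _ ⟨j, hj, rfl⟩
    induction j using Nat.strong_induction_on with
    | _ j ih =>
      obtain ⟨c, hc, hm⟩ := h j
      have h1 : e' j - c • e j ∈ Submodule.span K (e' '' S) := by
        refine (Submodule.span_le.2 ?_) hm
        rintro _ ⟨i, hi, rfl⟩
        exact ih i hi.1 (hS j hj i hi.1 hi.2)
      have h2 : e' j ∈ Submodule.span K (e' '' S) := Submodule.subset_span ⟨j, hj, rfl⟩
      have h3 : c • e j ∈ Submodule.span K (e' '' S) := by
        simpa using Submodule.sub_mem _ h2 h1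
      have h4 := Submodule.smul_mem _ c⁻¹ h3
      rwa [smul_smul, inv_mul_cancel₀ hc, one_smul] at h4

/-- the four possible values -/
def toK (K : Type*) [Field K] (t : Bool × Bool) : K × K :=
  (if t.1 then 1 else 0, if t.2 then 1 else 0)

def det2 (u v : K × K) : K := u.1 * v.2 - u.2 * v.1

lemma exists_psi (u v : K × K) (h : det2 u v ≠ 0) :
    ∃ ψ : (K × K) ≃ₗ[K] (K × K), ψ u = (1, 0) ∧ ψ v = (0, 1) := by
  obtain ⟨p, q⟩ := u
  obtain ⟨r, s⟩ := v
  simp only [det2] at h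
  let T : (K × K) →ₗ[K] (K × K) :=
    { toFun := fun z => ((z.1 * s - z.2 * r) / (p * s - q * r), (p * z.2 - q * z.1) / (p * s - q * r))
      map_add' := by intro x y; ext <;> simp <;> ring
      map_smul' := by intro x y; ext <;> simp <;> ring }
  have hinj : Function.Injective T := by
    rw [← LinearMap.ker_eq_bot, LinearMap.ker_eq_bot']
    rintro ⟨x, y⟩ hxy
    simp only [T, LinearMap.coe_mk, AddHom.coe_mk, Prod.mk_eq_zero, div_eq_zero_iff, h, or_false] at hxy
    obtain ⟨h1, h2⟩ := hxy
    have hx : (p * s - q * r) * x = 0 := by linear_combination p * h1 + r * h2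
    have hy : (p * s - q * r) * y = 0 := by linear_combination q * h1 + s * h2
    simp only [mul_eq_zero, h, false_or] at hx hy
    simp [hx, hy]
  refine ⟨LinearEquiv.ofInjectiveEndo T hinj, ?_, ?_⟩
  · simp only [LinearEquiv.coe_ofInjectiveEndo, T, LinearMap.coe_mk, AddHom.coe_mk]
    ext
    · exact div_self h
    · simp; left; ring
  · simp only [LinearEquiv.coe_ofInjectiveEndo, T, LinearMap.coe_mk, AddHom.coe_mk]
    ext
    · simp; left; ring
    · exact div_self h

lemma exists_indep (u : K × K) (h : u ≠ 0) : ∃ v : K × K, det2 u v ≠ 0 := by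
  by_cases h1 : u.1 = 0
  · refine ⟨(1, 0), ?_⟩
    intro h2
    simp [det2] at h2
    exact h (Prod.ext h1 h2)
  · exact ⟨(0, 1), by simpa [det2] using h1⟩

lemma exists_smul (u v : K × K) (hu : u ≠ 0) (hv : v ≠ 0) (h : det2 u v = 0) :
    ∃ c : K, c ≠ 0 ∧ v = c • u := by
  suffices ∃ c : K, v = c • u by
    obtain ⟨c, hc⟩ := this
    refine ⟨c, ?_, hc⟩
    rintro rfl
    simp at hc
    exact hv hc
  obtain ⟨p, q⟩ := u
  obtain ⟨r, s⟩ := v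
  simp only [det2] at h
  by_cases hp : p = 0
  · subst hp
    have hq : q ≠ 0 := by
      rintro rfl
      exact hu rfl
    have hr : r = 0 := by simpa [hq] using h
    exact ⟨s / q, by ext <;> simp [hr, hq]⟩
  · refine ⟨r / p, ?_⟩
    ext
    · simp [hp]
    · simp
      field_simp
      linear_combination h

/-- good vectors: proportional to one of three standard vectors -/
def Good (u : K × K) : Prop :=
  ∃ (c : K) (f : K × K), c ≠ 0 ∧ u = c • f ∧ (f = (1, 0) ∨ f = (0, 1) ∨ f = (1, 1))

lemma Good.smul {u : K × K} (h : Good u) {c : K} (hc : c ≠ 0) : Good (c • u) := by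
  obtain ⟨d, f, hd, rfl, hf⟩ := h
  exact ⟨c * d, f, mul_ne_zero hc hd, by rw [smul_smul], hf⟩

lemma good10 : Good ((1, 0) : K × K) := ⟨1, (1, 0), one_ne_zero, by simp, Or.inl rfl⟩
lemma good01 : Good ((0, 1) : K × K) := ⟨1, (0, 1), one_ne_zero, by simp, Or.inr (Or.inl rfl)⟩

lemma two_lines (u v : K × K) (hu : u ≠ 0) (hv : v ≠ 0) :
    ∃ ψ : (K × K) ≃ₗ[K] (K × K), Good (ψ u) ∧ Good (ψ v) := by
  by_cases h : det2 u v = 0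
  · obtain ⟨c, hc, rfl⟩ := exists_smul u v hu hv h
    obtain ⟨w, hw⟩ := exists_indep u hu
    obtain ⟨ψ, h1, h2⟩ := exists_psi u w hw
    exact ⟨ψ, h1 ▸ good10, by rw [map_smul, h1]; exact good10.smul hc⟩
  · obtain ⟨ψ, h1, h2⟩ := exists_psi u v h
    exact ⟨ψ, h1 ▸ good10, h2 ▸ good01⟩

lemma three_lines (u v w : K × K) (hu : u ≠ 0) (hv : v ≠ 0) (hw : w ≠ 0) :
    ∃ ψ : (K × K) ≃ₗ[K] (K × K), Good (ψ u) ∧ Good (ψ v) ∧ Good (ψ w) := by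
  by_cases h : det2 u v = 0
  · obtain ⟨c, hc, rfl⟩ := exists_smul u v hu hv h
    obtain ⟨ψ, h1, h2⟩ := two_lines u w hu hw
    exact ⟨ψ, h1, by rw [map_smul]; exact h1.smul hc, h2⟩
  · by_cases h' : det2 u w = 0
    · obtain ⟨c, hc, rfl⟩ := exists_smul u w hu hw h'
      obtain ⟨ψ, h1, h2⟩ := two_lines u v hu hv
      exact ⟨ψ, h1, h2, by rw [map_smul]; exact h1.smul hc⟩
    · by_cases h'' : det2 v w = 0
      · obtain ⟨c, hc, rfl⟩ := exists_smul v w hv hw h''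
        obtain ⟨ψ, h1, h2⟩ := two_lines u v hu hv
        exact ⟨ψ, h1, h2, by rw [map_smul]; exact h2.smul hc⟩
      · -- w is a combination of scaled u and v
        have key : det2 (det2 w v • u) (det2 u w • v) ≠ 0 := by
          have : det2 (det2 w v • u) (det2 u w • v)
              = - (det2 v w * det2 u w * det2 u v) := by
            simp [det2]; ring
          rw [this]
          exact neg_ne_zero.2 (mul_ne_zero (mul_ne_zero h'' h') h)
        have hwv : det2 w v ≠ 0 := by
          have : det2 w v = - det2 v w := by simp [det2]; ring
          rw [this]; exact neg_ne_zero.2 h''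
        have comb : det2 u v • w = det2 w v • u + det2 u w • v := by
          ext <;> simp [det2] <;> ring
        obtain ⟨ψ, h1, h2⟩ := exists_psi _ _ key
        have hu' : u = (det2 w v)⁻¹ • (det2 w v • u) := by
          rw [smul_smul, inv_mul_cancel₀ hwv, one_smul]
        have hv' : v = (det2 u w)⁻¹ • (det2 u w • v) := by
          rw [smul_smul, inv_mul_cancel₀ h', one_smul]
        have hw' : w = (det2 u v)⁻¹ • (det2 w v • u + det2 u w • v) := by
          rw [← comb, smul_smul, inv_mul_cancel₀ h, one_smul]
        refine ⟨ψ, ?_, ?_, ?_⟩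
        · have : ψ u = (det2 w v)⁻¹ • (1, 0) := by rw [← h1, ← map_smul, ← hu']
          rw [this]; exact good10.smul (inv_ne_zero hwv)
        · have : ψ v = (det2 u w)⁻¹ • (0, 1) := by rw [← h2, ← map_smul, ← hv']
          rw [this]; exact good01.smul (inv_ne_zero h')
        · have : ψ w = (det2 u v)⁻¹ • (1, 1) := by
            have h3 : ((1, 1) : K × K) = (1, 0) + (0, 1) := by simp
            rw [h3, ← h1, ← h2, ← map_add, ← map_smul, ← hw']
          rw [this]
          exact ⟨_, _, inv_ne_zero h, rfl, Or.inr (Or.inr rfl)⟩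

lemma good_compl (f : K × K) (hf : f = (1, 0) ∨ f = (0, 1) ∨ f = (1, 1)) (z : K × K) :
    ∃ (al be : K) (w : Bool × Bool), z = al • f + be • toK K w := by
  rcases hf with rfl | rfl | rfl
  · exact ⟨z.1, z.2, (false, true), by ext <;> simp [toK]⟩
  · exact ⟨z.2, z.1, (true, false), by ext <;> simp [toK]⟩
  · exact ⟨z.2, z.1 - z.2, (true, false), by ext <;> simp [toK]⟩

lemma good_toK (f : K × K) (hf : f = (1, 0) ∨ f = (0, 1) ∨ f = (1, 1)) : ∃ t, f = toK K t := by
  rcases hf with rfl | rfl | rfl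
  · exact ⟨(true, false), by simp [toK]⟩
  · exact ⟨(false, true), by simp [toK]⟩
  · exact ⟨(true, true), by simp [toK]⟩

lemma stage2 (φ : V →ₗ[K] (K × K)) (e : ℕ → V) (lam : ℕ → ℕ) (hlam : ∀ j, lam j ≤ 2) :
    ∃ (ψ : (K × K) ≃ₗ[K] (K × K)) (e' : ℕ → V) (M : ℕ → Bool × Bool),
      (∀ j, ∃ c : K, c ≠ 0 ∧
        e' j - c • e j ∈ Submodule.span K (e '' {i | i < j ∧ lam i = lam j})) ∧
      ∀ j, ψ (φ (e' j)) = toK K (M j) := by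
  classical
  have hu : ∀ s : ℕ, ∃ u : K × K, u ≠ 0 ∧ ∀ j, lam j = s → φ (e j) ≠ 0 →
      (∀ i < j, lam i = s → φ (e i) = 0) → φ (e j) = u := by
    intro s
    by_cases h : ∃ j, lam j = s ∧ φ (e j) ≠ 0
    · refine ⟨φ (e (Nat.find h)), (Nat.find_spec h).2, fun j h1 h2 h3 => ?_⟩
      rcases lt_trichotomy (Nat.find h) j with h4 | h4 | h4
      · exact absurd (h3 _ h4 (Nat.find_spec h).1) (Nat.find_spec h).2
      · rw [h4]
      · exact absurd ⟨h1, h2⟩ (Nat.find_min h h4)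
    · push Not at h
      exact ⟨(1, 0), by simp, fun j h1 h2 => absurd (h j h1) h2⟩
  choose u hu0 hu using hu
  obtain ⟨ψ, g0, g1, g2⟩ := three_lines (u 0) (u 1) (u 2) (hu0 _) (hu0 _) (hu0 _)
  have hg : ∀ s ≤ 2, Good (ψ (u s)) := by
    intro s hs
    interval_cases s <;> assumption
  have main : ∀ j, ∃ (v : V) (t : Bool × Bool), (∃ c : K, c ≠ 0 ∧
        v - c • e j ∈ Submodule.span K (e '' {i | i < j ∧ lam i = lam j})) ∧
        ψ (φ v) = toK K t := by
    intro j
    obtain ⟨d, f, hd, hdf, hf⟩ := hg (lam j) (hlam j)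
    by_cases h : ∃ i, i < j ∧ lam i = lam j ∧ φ (e i) ≠ 0
    · set i := Nat.find h with hi
      obtain ⟨h1, h2, h3⟩ := Nat.find_spec h
      have h4 : φ (e i) = u (lam j) := by
        apply hu _ _ h2 h3
        intro i' hi' hl
        by_contra hne
        exact Nat.find_min h hi' ⟨hi'.trans h1, hl, hne⟩
      have hmem : e i ∈ Submodule.span K (e '' {i | i < j ∧ lam i = lam j}) :=
        Submodule.subset_span ⟨i, ⟨h1, h2⟩, rfl⟩
      obtain ⟨al, be, w, hz⟩ := good_compl f hf (ψ (φ (e j)))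
      have h5 : ψ (φ (e j - (al / d) • e i)) = be • toK K w := by
        rw [map_sub, map_smul, map_sub, map_smul, h4, hdf, hz, smul_smul, div_mul_cancel₀ _ hd]
        simp
      by_cases hb : be = 0
      · refine ⟨e j - (al / d) • e i, (false, false), ⟨1, one_ne_zero, ?_⟩, ?_⟩
        · rw [one_smul, sub_sub_cancel_left]
          exact Submodule.neg_mem _ (Submodule.smul_mem _ _ hmem)
        · rw [h5, hb]; ext <;> simp [toK]
      · refine ⟨be⁻¹ • (e j - (al / d) • e i), w, ⟨be⁻¹, inv_ne_zero hb, ?_⟩, ?_⟩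
        · rw [smul_sub, sub_sub_cancel_left]
          exact Submodule.neg_mem _ (Submodule.smul_mem _ _ (Submodule.smul_mem _ _ hmem))
        · rw [map_smul, map_smul, h5, smul_smul, inv_mul_cancel₀ hb, one_smul]
    · push Not at h
      by_cases h0 : φ (e j) = 0
      · exact ⟨e j, (false, false), ⟨1, one_ne_zero, by simp⟩, by ext <;> simp [h0, toK]⟩
      · have h4 := hu _ _ rfl h0 h
        obtain ⟨t, ht⟩ := good_toK f hf
        refine ⟨d⁻¹ • e j, t, ⟨d⁻¹, inv_ne_zero hd, by simp⟩, ?_⟩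
        rw [map_smul, map_smul, h4, hdf, smul_smul, inv_mul_cancel₀ hd, one_smul, ht]
  choose e' M h1 h2 using main
  exact ⟨ψ, e', M, h1, h2⟩

/-- Normal form relation. -/
def NF (n : ℕ) (ι : Type*) (t : (Fin n → ℕ × (Bool × Bool)) × (ι → ℕ))
    (x : Submodule K V × (Submodule K V × Submodule K V) × (ι → Submodule K V)) : Prop :=
  ∃ (e : Basis (Fin n) K V) (φ : V →ₗ[K] (K × K)),
    x.1 = LinearMap.ker φ ∧ (∀ j, φ (e j) = toK K (t.1 j).2) ∧
    x.2.1.1 = Submodule.span K (e '' {j | (t.1 j).1 ≤ 0}) ∧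
    x.2.1.2 = Submodule.span K (e '' {j | (t.1 j).1 ≤ 1}) ∧
    ∀ i, x.2.2 i = Submodule.span K (e '' {j | j.val < t.2 i})

/-- same orbit -/
def Rel {ι : Type*}
    (x x' : Submodule K V × (Submodule K V × Submodule K V) × (ι → Submodule K V)) : Prop :=
  ∃ g : V ≃ₗ[K] V,
            x.1.map g.toLinearMap = x'.1 ∧
            x.2.1.1.map g.toLinearMap = x'.2.1.1 ∧
            x.2.1.2.map g.toLinearMap = x'.2.1.2 ∧
            ∀ j, (x.2.2 j).map g.toLinearMap = x'.2.2 j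

lemma NF.rel {n : ℕ} {ι : Type*} {t : (Fin n → ℕ × (Bool × Bool)) × (ι → ℕ)}
    {x x' : Submodule K V × (Submodule K V × Submodule K V) × (ι → Submodule K V)}
    (h : NF n ι t x) (h' : NF n ι t x') : Rel x x' := by
  obtain ⟨e, φ, hA, hφ, hB1, hB2, hC⟩ := h
  obtain ⟨e', φ', hA', hφ', hB1', hB2', hC'⟩ := h'
  have hS : ∀ S : Set (Fin n), (Submodule.span K (e '' S)).map
      (e.equiv e' (Equiv.refl _)).toLinearMap = Submodule.span K (e' '' S) := by
    intro S
    rw [Submodule.map_span, ← Set.image_comp]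
    congr 1
    apply Set.image_congr
    intro j _
    simp
  refine ⟨e.equiv e' (Equiv.refl _), ?_, ?_, ?_, ?_⟩
  · have : φ = φ' ∘ₗ (e.equiv e' (Equiv.refl _)).toLinearMap := by
      apply e.ext
      intro j
      simp [hφ, hφ']
    rw [hA, hA', this, LinearMap.ker_comp]
    exact Submodule.map_comap_eq_of_surjective (LinearEquiv.surjective _) _
  · rw [hB1, hB1', hS]
  · rw [hB2, hB2', hS]
  · intro j
    rw [hC, hC', hS]

lemma exists_phi [FiniteDimensional K V] (A : Submodule K V)
    (hA : finrank K V ≤ finrank K A + 2) : ∃ φ : V →ₗ[K] (K × K), A = LinearMap.ker φ := by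
  have h1 := Submodule.finrank_quotient_add_finrank A
  have h2 : finrank K (V ⧸ A) ≤ finrank K (K × K) := by
    simp; omega
  obtain ⟨f, hf⟩ : ∃ f : (V ⧸ A) →ₗ[K] (K × K), Function.Injective f := by
    exact finrank_le_iff_exists_linearMap.1 h2
  refine ⟨f ∘ₗ A.mkQ, ?_⟩
  rw [LinearMap.ker_comp, LinearMap.ker_eq_bot.2 hf]
  simp

lemma exists_NF [FiniteDimensional K V] {ι : Type*} [Finite ι] (n : ℕ) (hn : finrank K V = n)
    (x : Submodule K V × (Submodule K V × Submodule K V) × (ι → Submodule K V))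
    (hA : n ≤ finrank K x.1 + 2) (hB : x.2.1.1 ≤ x.2.1.2)
    (hC : ∀ i j, x.2.2 i ≤ x.2.2 j ∨ x.2.2 j ≤ x.2.2 i) :
    ∃ t : (Fin n → ℕ × (Bool × Bool)) × (ι → ℕ),
      ((∀ j, (t.1 j).1 ≤ 2) ∧ ∀ i, t.2 i ≤ n) ∧ NF n ι t x := by
  obtain ⟨A, ⟨B1, B2⟩, C⟩ := x
  simp only at hA hB hC
  obtain ⟨φ, hφ⟩ := exists_phi A (hn ▸ hA)
  let B : ℕ → Submodule K V := fun s => if s = 0 then B1 else if s = 1 then B2 else ⊤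
  have hBm : Monotone B := by
    apply monotone_nat_of_le_succ
    intro s
    rcases s with _ | _ | s <;> simp [B, hB]
  obtain ⟨e, lam, hlam, heC, heB⟩ := stage1 C hC B hBm (by simp [B]) n ⊤ (by simpa using hn)
    (fun i => Or.inl le_top)
  obtain ⟨ψ, e', M, he', hM⟩ := stage2 φ e lam hlam
  have tri := span_tri e e' lam he'
  have hB' : ∀ s, B s = Submodule.span K (e' '' {j | j < n ∧ lam j ≤ s}) := by
    intro s
    rw [tri {j | j < n ∧ lam j ≤ s} (fun j hj i hi hl => ⟨hi.trans hj.1, hl.trans_le hj.2⟩), ← heB, inf_top_eq]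
  have hC' : ∀ i, ∃ m ≤ n, C i = Submodule.span K (e' '' {j | j < m}) := by
    intro i
    obtain ⟨m, hm, h⟩ := heC i le_top
    exact ⟨m, hm, by rw [tri {j | j < m} (fun j hj i hi hl => hi.trans hj), h]⟩
  choose m hm hC' using hC'
  let b : Fin n → V := fun j => e' j
  have himg : ∀ P : ℕ → Prop, (∀ j, P j → j < n) → e' '' {j | P j} = b '' {j : Fin n | P j} := by
    intro P hP
    ext v
    constructor
    · rintro ⟨j, hj, rfl⟩
      exact ⟨⟨j, hP j hj⟩, hj, rfl⟩
    · rintro ⟨j, hj, rfl⟩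
      exact ⟨j, hj, rfl⟩
  have hBb : ∀ s, B s = Submodule.span K (b '' {j | lam j ≤ s}) := by
    intro s
    rw [hB', himg _ (fun j hj => hj.1)]
    simp
  have hspan : ⊤ ≤ Submodule.span K (Set.range b) := by
    have := hBb 2
    simp only [B] at this
    simp at this
    rw [this]
    exact Submodule.span_mono (Set.image_subset_range _ _)
  let bb := basisOfTopLeSpanOfCardEqFinrank b hspan (by simp [hn])
  have hbb : (bb : Fin n → V) = b := coe_basisOfTopLeSpanOfCardEqFinrank _ _ _
  refine ⟨(fun j => (lam j, M j), m), ⟨fun j => hlam j, hm⟩, bb, ψ.toLinearMap ∘ₗ φ, ?_, ?_, ?_, ?_, ?_⟩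
  · simp [LinearMap.ker_comp, hφ]
  · intro j
    rw [hbb]
    simpa [b] using hM j
  · rw [hbb]; exact hBb 0
  · rw [hbb]; exact hBb 1
  · intro i
    rw [hbb]
    simp only
    rw [hC', himg _ (fun j hj => lt_of_lt_of_le hj (hm i))]

lemma Rel.symm {ι : Type*}
    {x y : Submodule K V × (Submodule K V × Submodule K V) × (ι → Submodule K V)}
    (h : Rel x y) : Rel y x := by
  obtain ⟨g, h1, h2, h3, h4⟩ := h
  have key : ∀ S : Submodule K V, (S.map g.toLinearMap).map g.symm.toLinearMap = S := by
    intro S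
    rw [← Submodule.map_comp]
    simp
  exact ⟨g.symm, by rw [← h1, key], by rw [← h2, key], by rw [← h3, key],
    fun j => by rw [← h4, key]⟩

lemma Rel.trans {ι : Type*}
    {x y z : Submodule K V × (Submodule K V × Submodule K V) × (ι → Submodule K V)}
    (h : Rel x y) (h' : Rel y z) : Rel x z := by
  obtain ⟨g, h1, h2, h3, h4⟩ := h
  obtain ⟨g', h1', h2', h3', h4'⟩ := h'
  have key : ∀ S : Submodule K V, S.map (g.trans g').toLinearMap =
      (S.map g.toLinearMap).map g'.toLinearMap := by
    intro S
    rw [← Submodule.map_comp]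
    rfl
  exact ⟨g.trans g', by rw [key, h1, h1'], by rw [key, h2, h2'], by rw [key, h3, h3'],
    fun j => by rw [key, h4, h4']⟩

/-- dual configuration -/
def dualC {ι : Type*} (x : Submodule K V × (Submodule K V × Submodule K V) × (ι → Submodule K V)) :
    Submodule K (Dual K V) × (Submodule K (Dual K V) × Submodule K (Dual K V)) ×
      (ι → Submodule K (Dual K V)) :=
  (x.1.dualAnnihilator, (x.2.1.2.dualAnnihilator, x.2.1.1.dualAnnihilator),
    fun i => (x.2.2 i).dualAnnihilator)

lemma rel_of_dual [FiniteDimensional K V] {ι : Type*}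
    {x y : Submodule K V × (Submodule K V × Submodule K V) × (ι → Submodule K V)}
    (h : Rel (dualC x) (dualC y)) : Rel x y := by
  obtain ⟨g, h1, h2, h3, h4⟩ := h
  let h : V ≃ₗ[K] V := ((evalEquiv K V).trans g.symm.dualMap).trans (evalEquiv K V).symm
  have hh : ∀ (p : Dual K V) (v : V), p (h v) = (g.symm p) v := by
    intro p v
    simp [h]
  have key : ∀ S S' : Submodule K V, S.dualAnnihilator.map g.toLinearMap = S'.dualAnnihilator →
      S.map h.toLinearMap = S' := by
    intro S S' hSS
    have : S = S'.comap h.toLinearMap := by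
      ext v
      rw [Submodule.mem_comap, ← Subspace.forall_mem_dualAnnihilator_apply_eq_zero_iff S,
        ← Subspace.forall_mem_dualAnnihilator_apply_eq_zero_iff S', ← hSS]
      constructor
      · rintro H _ ⟨p, hp, rfl⟩
        have := H p hp
        simpa [hh] using this
      · intro H p hp
        have := H (g p) ⟨p, hp, rfl⟩
        simpa [hh] using this
    rw [this]
    exact Submodule.map_comap_eq_of_surjective h.surjective _
  exact ⟨h, key _ _ h1, key _ _ h3, key _ _ h2, fun j => key _ _ (h4 j)⟩

lemma finite_orb {X T : Type*} (P : X → Prop) (R : X → X → Prop)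
    (symm : ∀ x y, R x y → R y x) (trans : ∀ x y z, R x y → R y z → R x z)
    (Q : Set T) (hQ : Q.Finite) (N : T → X → Prop) (hex : ∀ x, P x → ∃ t ∈ Q, N t x)
    (hN : ∀ t x y, N t x → N t y → R x y) :
    {O : Set X | ∃ x, P x ∧ O = {y | R x y}}.Finite := by
  classical
  refine (hQ.image (fun t => {y | ∃ x, N t x ∧ R x y})).subset ?_
  rintro O ⟨x, hx, rfl⟩
  obtain ⟨t, ht, hNt⟩ := hex x hx
  refine ⟨t, ht, ?_⟩
  ext y
  constructor
  · rintro ⟨x', h1, h2⟩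
    exact trans _ _ _ (hN t _ _ hNt h1) h2
  · intro h
    exact ⟨x, hNt, h⟩

lemma finite_Q (n : ℕ) (ι : Type*) [Finite ι] :
    {t : (Fin n → ℕ × (Bool × Bool)) × (ι → ℕ) |
      (∀ j, (t.1 j).1 ≤ 2) ∧ ∀ i, t.2 i ≤ n}.Finite := by
  have h1 : (Set.pi Set.univ (fun _ : Fin n => (Set.Iic 2 ×ˢ Set.univ : Set (ℕ × (Bool × Bool))))).Finite :=
    Set.Finite.pi' (fun _ => (Set.finite_Iic 2).prod Set.finite_univ) |>.subset
      (fun t ht j => ht j trivial)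
  have h2 : (Set.pi Set.univ (fun _ : ι => (Set.Iic n : Set ℕ))).Finite :=
    Set.Finite.pi' (fun _ => Set.finite_Iic n) |>.subset (fun t ht j => ht j trivial)
  refine (h1.prod h2).subset ?_
  rintro t ⟨ha, hb⟩
  exact ⟨fun j _ => ⟨ha j, trivial⟩, fun i _ => hb i⟩

end

end FinOrb

theorem finitely_many_orbits_one_two_ell_small_a
    (K : Type*) [Field K] [IsAlgClosed K] (V : Type*) [AddCommGroup V] [Module K V]
    [FiniteDimensional K V] (n ℓ a b1 b2 : ℕ) (hn : finrank K V = n)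
    (hl1 : 1 ≤ ℓ) (ha2 : min a (n - a) ≤ 2)
    (c : Fin ℓ → ℕ) (hc : StrictMono c)
    (ha0 : 0 < a) (han : a < n)
    (hb10 : 0 < b1) (hb12 : b1 < b2) (hb2n : b2 < n)
    (hc0 : ∀ j, 0 < c j) (hcn : ∀ j, c j < n) :
    { O : Set (Submodule K V × (Submodule K V × Submodule K V) × (Fin ℓ → Submodule K V)) |
        ∃ x : Submodule K V × (Submodule K V × Submodule K V) × (Fin ℓ → Submodule K V),
          (finrank K x.1 = a ∧
            x.2.1.1 ≤ x.2.1.2 ∧ finrank K x.2.1.1 = b1 ∧ finrank K x.2.1.2 = b2 ∧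
            Monotone x.2.2 ∧ (∀ j, finrank K (x.2.2 j) = c j)) ∧
          O = { x' | ∃ g : V ≃ₗ[K] V,
            x.1.map g.toLinearMap = x'.1 ∧
            x.2.1.1.map g.toLinearMap = x'.2.1.1 ∧
            x.2.1.2.map g.toLinearMap = x'.2.1.2 ∧
            ∀ j, (x.2.2 j).map g.toLinearMap = x'.2.2 j } }.Finite := by
  have hdim : n ≤ a + 2 ∨ a ≤ 2 := by omega
  rcases hdim with hd | hd
  · refine FinOrb.finite_orb _ FinOrb.Rel (fun x y h => h.symm) (fun x y z h h' => h.trans h')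
      _ (FinOrb.finite_Q n (Fin ℓ)) (FinOrb.NF n (Fin ℓ)) ?_ (fun t x y h h' => h.rel h')
    rintro x ⟨h1, h2, -, -, h3, -⟩
    exact FinOrb.exists_NF n hn x (by omega) h2
      (fun i j => (le_total i j).imp (fun h => h3 h) (fun h => h3 h))
  · refine FinOrb.finite_orb _ FinOrb.Rel (fun x y h => h.symm) (fun x y z h h' => h.trans h')
      _ (FinOrb.finite_Q n (Fin ℓ)) (fun t x => FinOrb.NF n (Fin ℓ) t (FinOrb.dualC x)) ?_
      (fun t x y h h' => FinOrb.rel_of_dual (h.rel h'))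
    rintro x ⟨h1, h2, -, -, h3, -⟩
    have hda := Subspace.finrank_add_finrank_dualAnnihilator_eq x.1
    refine FinOrb.exists_NF n (by rw [Subspace.dual_finrank_eq, hn]) (FinOrb.dualC x) ?_
      (Submodule.dualAnnihilator_anti h2)
      (fun i j => (le_total j i).imp (fun h => Submodule.dualAnnihilator_anti (h3 h))
        (fun h => Submodule.dualAnnihilator_anti (h3 h)))
    change n ≤ finrank K x.1.dualAnnihilator + 2
    omega
end

section
/- Let K be an algebraically closed field and V a K-vector space of dimension n. Fix dimension types 0 < a < n, 0 < b_1 < b_2 < n with min(b_1, b_2 − b_1, n − b_2) = 1, and 0 < c_1 < ... < c_ℓ < n for an arbitrary integer ℓ ≥ 1. Then the GL(V)-action on triples (A, B_1 ⊆ B_2, C_1 ⊆ ... ⊆ C_ℓ), where A is a subspace of dimension a, (B_1, B_2) is a partial flag of type (b_1, b_2), and (C_1, ..., C_ℓ) is a partial flag of type (c_1, ..., c_ℓ), has finitely many orbits. -/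
open Module

namespace OrbAux
open Submodule

variable {K : Type*} [Field K] {V : Type*} [AddCommGroup V] [Module K V]

structure Good {ℓ : ℕ} {ι : Type} (H A B : Submodule K V) (C : Fin ℓ → Submodule K V)
    (e : ι → V) (p : ι → ι) : Prop where
  li : LinearIndependent K e
  sp : span K (Set.range e) = H
  hA : A ≤ span K {v | v ∈ A ∧ ((∃ i, v = e i) ∨ ∃ i k, i ≠ k ∧ p i = p k ∧ v = e i + e k)}
  hB : B ≤ span K {v | v ∈ B ∧ ∃ i, v = e i}
  hC : ∀ j, C j ≤ span K {v | v ∈ C j ∧ ∃ i, v = e i}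
  p1 : ∀ i k, i ≠ k → p i = p k → e i ∈ A ⊔ B ∧ (e i ∈ B ↔ e k ∉ B)

lemma cov_decomp {H' H A : Submodule K V} (hcov : H' ⋖ H) {x : V} (hx : x ∉ H') (hxA : x ∈ A)
    (hA : A ≤ H) : A ≤ (A ⊓ H') ⊔ span K {x} := by
  have h1 : H ≤ H' ⊔ span K {x} := by
    have hxH := hA hxA
    have : H' < H' ⊔ span K {x} := by
      refine lt_of_le_of_ne le_sup_left ?_
      intro h
      apply hx
      rw [h]
      exact mem_sup_right (mem_span_singleton_self x)
    have h2 : H' ⊔ span K {x} ≤ H := sup_le hcov.le (by simpa [span_le] using hxH)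
    by_contra hcon
    exact hcov.2 this (lt_of_le_not_ge h2 hcon)
  intro y hy
  obtain ⟨h, hh, z, hz, rfl⟩ := mem_sup.1 (h1 (hA hy))
  obtain ⟨c, rfl⟩ := mem_span_singleton.1 hz
  refine add_mem (mem_sup_left ⟨?_, hh⟩) (mem_sup_right hz)
  have := A.sub_mem hy (A.smul_mem c hxA)
  simpa using this

lemma ext {ℓ : ℕ} {ι : Type} {H' H A B : Submodule K V} {C : Fin ℓ → Submodule K V}
    {e : ι → V} {p : ι → ι}
    (G : Good H' (A ⊓ H') (B ⊓ H') (fun j => C j ⊓ H') e p) (hcov : H' ⋖ H)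
    {x : V} (hx : x ∉ H') (hxH : x ∈ H) (hA : A ≤ H) (hB : B ≤ H)
    (hC : ∀ j, C j = H ∨ C j ≤ H') (hBx : B ≤ H' ∨ x ∈ B) (q : Option ι)
    (hAx : A ≤ H' ∨ ∃ a, a ∈ A ∧ a ∉ H' ∧ (a = x ∨ ∃ i, q = some (p i) ∧ a = e i + x))
    (hq : ∀ k, q = some (p k) → (x ∈ A ⊔ B ∧ e k ∈ A ⊔ B) ∧ (x ∈ B ↔ e k ∉ B)) :
    Good H A B C (fun o : Option ι => o.elim x e) (fun o => o.elim q (fun i => some (p i))) := by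
  have heH : ∀ i, e i ∈ H' := fun i => by rw [← G.sp]; exact subset_span ⟨i, rfl⟩
  have hcoord : ∀ W : Submodule K V, W ≤ H → (W ≤ H' ∨ x ∈ W) →
      W ⊓ H' ≤ span K {v | v ∈ W ⊓ H' ∧ ∃ i, v = e i} →
      W ≤ span K {v | v ∈ W ∧ ∃ i : Option ι, v = i.elim x e} := by
    intro W hW h1 h2
    have h3 : W ⊓ H' ≤ span K {v | v ∈ W ∧ ∃ i : Option ι, v = i.elim x e} := by
      refine h2.trans (span_mono ?_)
      rintro v ⟨hv, i, rfl⟩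
      exact ⟨hv.1, some i, rfl⟩
    rcases h1 with h1 | h1
    · rwa [inf_eq_left.2 h1] at h3
    · refine (cov_decomp hcov hx h1 hW).trans (sup_le h3 ?_)
      exact span_mono (by rintro v rfl; exact ⟨h1, none, rfl⟩)
  refine ⟨?_, ?_, ?_, ?_, ?_, ?_⟩
  · rw [linearIndependent_option]
    refine ⟨G.li, ?_⟩
    show x ∉ span K (Set.range e)
    rw [G.sp]; exact hx
  · apply le_antisymm
    · rw [span_le]
      rintro _ ⟨o, rfl⟩
      cases o
      · exact hxH
      · exact hcov.le (heH _)
    · refine (cov_decomp hcov hx hxH le_rfl).trans (sup_le (inf_le_right.trans ?_) ?_)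
      · rw [← G.sp]
        refine span_mono ?_
        rintro _ ⟨i, rfl⟩
        exact ⟨some i, rfl⟩
      · exact span_mono (by rintro v rfl; exact ⟨none, rfl⟩)
  · have h3 : A ⊓ H' ≤ span K {v | v ∈ A ∧ ((∃ i : Option ι, v = i.elim x e) ∨
        ∃ i k : Option ι, i ≠ k ∧ i.elim q (fun i => some (p i)) = k.elim q (fun i => some (p i)) ∧
          v = i.elim x e + k.elim x e)} := by
      refine G.hA.trans (span_mono ?_)
      rintro v ⟨hv, ⟨i, rfl⟩ | ⟨i, k, hik, hp, rfl⟩⟩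
      · exact ⟨hv.1, Or.inl ⟨some i, rfl⟩⟩
      · exact ⟨hv.1, Or.inr ⟨some i, some k, by simpa using hik, by simpa using hp, rfl⟩⟩
    rcases hAx with h1 | ⟨a, haA, haH, h⟩
    · rwa [inf_eq_left.2 h1] at h3
    · refine (cov_decomp hcov haH haA hA).trans (sup_le h3 (span_mono ?_))
      rintro v rfl
      refine ⟨haA, ?_⟩
      rcases h with h | ⟨i, hi, h⟩
      · exact Or.inl ⟨none, h⟩
      · exact Or.inr ⟨some i, none, by simp, by simp [hi], h⟩
  · exact hcoord B hB hBx G.hB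
  · intro j
    refine hcoord (C j) ?_ ?_ (G.hC j)
    · rcases hC j with h | h
      · exact h.le
      · exact h.trans hcov.le
    · rcases hC j with h | h
      · right; rw [h]; exact hxH
      · exact Or.inl h
  · have hle : A ⊓ H' ⊔ B ⊓ H' ≤ A ⊔ B := sup_le_sup inf_le_left inf_le_left
    rintro (_ | i) (_ | k) hik hp
    · exact absurd rfl hik
    · exact ⟨(hq k hp).1.1, (hq k hp).2⟩
    · have := hq i hp.symm
      refine ⟨this.1.2, ?_⟩
      have := this.2
      simp only [Option.elim] 
      tauto
    · have := G.p1 i k (by simpa using hik) (by simpa using hp)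
      refine ⟨hle this.1, ?_⟩
      have h2 := this.2
      simp only [mem_inf, heH, and_true] at h2
      exact h2

lemma coordMem {ι : Type} {e : ι → V} (li : LinearIndependent K e) {W : Submodule K V}
    (hW : W ≤ span K {v | v ∈ W ∧ ∃ i, v = e i}) {s : ι →₀ K}
    (hs : Finsupp.linearCombination K e s ∈ W) {i : ι} (hi : s i ≠ 0) : e i ∈ W := by
  have h1 : {v | v ∈ W ∧ ∃ i, v = e i} = e '' {i | e i ∈ W} := by
    ext v; constructor
    · rintro ⟨hv, i, rfl⟩; exact ⟨i, hv, rfl⟩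
    · rintro ⟨i, hv, rfl⟩; exact ⟨hv, i, rfl⟩
  rw [h1] at hW
  obtain ⟨t, ht, hts⟩ := (Finsupp.mem_span_image_iff_linearCombination K).1 (hW hs)
  have : t = s := li hts
  subst this
  exact ht (by simpa using hi)

lemma swap_coord {ι : Type} {e e' : ι → V} {W : Submodule K V} (s : ι →₀ K)
    (i0 : ι) (hi0 : s i0 ≠ 0) (he' : e' i0 = Finsupp.linearCombination K e s)
    (hk : ∀ k, k ≠ i0 → e' k = e k)
    (hs : e i0 ∈ W → ∀ k, s k ≠ 0 → e k ∈ W)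
    (hW : W ≤ span K {v | v ∈ W ∧ ∃ i, v = e i}) :
    W ≤ span K {v | v ∈ W ∧ ∃ i, v = e' i} := by
  refine hW.trans (span_le.2 ?_)
  rintro v ⟨hv, i, rfl⟩
  by_cases hi : i = i0
  · subst hi
    have hs' := hs hv
    have h1 : Finsupp.linearCombination K e s =
        s i • e i + Finsupp.linearCombination K e (s.erase i) := by
      conv_lhs => rw [← Finsupp.single_add_erase i s]
      rw [map_add, Finsupp.linearCombination_single]
    have h2 : Finsupp.linearCombination K e (s.erase i) ∈
        span K {v | v ∈ W ∧ ∃ i, v = e' i} := by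
      rw [Finsupp.linearCombination_apply]
      refine sum_mem fun k hks => smul_mem _ _ (subset_span ?_)
      have hki : k ≠ i ∧ s k ≠ 0 := by
        classical
        rw [Finsupp.support_erase] at hks; simpa using hks
      exact ⟨hs' k hki.2, k, (hk k hki.1).symm⟩
    have h3 : Finsupp.linearCombination K e s ∈ span K {v | v ∈ W ∧ ∃ i, v = e' i} := by
      refine subset_span ⟨?_, i, he'.symm⟩
      rw [Finsupp.linearCombination_apply]
      refine sum_mem fun k hks => smul_mem _ _ (hs' k (by simpa using hks))
    have h4 : e i = (s i)⁻¹ • (Finsupp.linearCombination K e s -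
        Finsupp.linearCombination K e (s.erase i)) := by
      rw [h1, add_sub_cancel_right, smul_smul, inv_mul_cancel₀ hi0, one_smul]
    rw [h4]
    exact smul_mem _ _ (sub_mem h3 h2)
  · exact subset_span ⟨hv, i, (hk i hi).symm⟩

lemma swap {ℓ : ℕ} {ι : Type} {H A B : Submodule K V} {C : Fin ℓ → Submodule K V}
    {e : ι → V} {p : ι → ι} (G : Good H A B C e p) (s : ι →₀ K)
    (i0 : ι) (hi0 : s i0 ≠ 0) (hi0' : e i0 ∉ A ⊔ B)
    (hs : ∀ j, e i0 ∈ C j → ∀ k, s k ≠ 0 → e k ∈ C j) :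
    ∃ e' : ι → V, Good H A B C e' p ∧ e' i0 = Finsupp.linearCombination K e s := by
  classical
  have he0 : Function.update e i0 (Finsupp.linearCombination K e s) i0 =
    Finsupp.linearCombination K e s := by simp
  have hek : ∀ k, k ≠ i0 → Function.update e i0 (Finsupp.linearCombination K e s) k = e k :=
    fun k hk => by simp [hk]
  have hli := G.li.update i0 (Finsupp.linearCombination K e s)
    ⟨1, one_mem _, s, by simpa using hi0, by simp⟩
  revert he0 hek hli
  generalize Function.update e i0 (Finsupp.linearCombination K e s) = e'
  intro he0 hek hli
  have hpair : ∀ i k, i ≠ k → p i = p k → i ≠ i0 := by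
    rintro i k hik hp rfl
    exact hi0' (G.p1 _ _ hik hp).1
  have heH : ∀ i, e i ∈ H := fun i => by rw [← G.sp]; exact subset_span ⟨i, rfl⟩
  refine ⟨e', ⟨hli, ?_, ?_, ?_, ?_, ?_⟩, he0⟩
  · apply le_antisymm
    · rw [span_le]
      rintro _ ⟨i, rfl⟩
      by_cases hi : i = i0
      · subst hi
        rw [he0, Finsupp.linearCombination_apply]
        exact sum_mem fun k hks => smul_mem _ _ (heH k)
      · rw [hek i hi]; exact heH i
    · refine (swap_coord s i0 hi0 he0 hek (fun _ k _ => heH k) ?_).trans (span_mono ?_)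
      · conv_lhs => rw [← G.sp]
        refine span_mono ?_
        rintro _ ⟨i, rfl⟩
        exact ⟨heH i, i, rfl⟩
      · rintro v ⟨_, i, rfl⟩
        exact ⟨i, rfl⟩
  · refine G.hA.trans (span_mono ?_)
    rintro v ⟨hv, ⟨i, rfl⟩ | ⟨i, k, hik, hp, rfl⟩⟩
    · refine ⟨hv, Or.inl ⟨i, (hek i ?_).symm⟩⟩
      rintro rfl
      exact hi0' (mem_sup_left hv)
    · refine ⟨hv, Or.inr ⟨i, k, hik, hp, ?_⟩⟩
      rw [hek i (hpair _ _ hik hp), hek k (hpair _ _ hik.symm hp.symm)]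
  · exact swap_coord s i0 hi0 he0 hek (fun h => absurd (mem_sup_right h) hi0') G.hB
  · exact fun j => swap_coord s i0 hi0 he0 hek (hs j) (G.hC j)
  · intro i k hik hp
    rw [hek i (hpair _ _ hik hp), hek k (hpair _ _ hik.symm hp.symm)]
    exact G.p1 i k hik hp

lemma exists_last {ℓ : ℕ} {ι : Type} (C : Fin ℓ → Submodule K V) (hC : Monotone C) (e : ι → V)
    (s : ι →₀ K) (hs : s ≠ 0) :
    ∃ i0, s i0 ≠ 0 ∧ ∀ j, e i0 ∈ C j → ∀ k, s k ≠ 0 → e k ∈ C j := by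
  classical
  obtain ⟨i0, hi0, hmin⟩ := Finset.exists_min_image s.support
    (fun i => (Finset.univ.filter (fun j => e i ∈ C j)).card) (by simpa using hs)
  refine ⟨i0, by simpa using hi0, ?_⟩
  intro j hj k hk
  by_contra hcon
  have h1 := hmin k (by simpa using hk)
  refine absurd h1 (not_le.2 (Finset.card_lt_card ?_))
  rw [Finset.ssubset_iff_of_subset]
  · exact ⟨j, by simpa using hj, by simpa using hcon⟩
  · intro j' hj'
    simp only [Finset.mem_filter, Finset.mem_univ, true_and] at hj' ⊢
    rcases le_total j j' with h | h
    · exact hC h hj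
    · exact absurd (hC h hj') hcon

lemma exists_hyper {ℓ : ℕ} [FiniteDimensional K V] (H : Submodule K V) (hH : H ≠ ⊥)
    (C : Fin ℓ → Submodule K V) (hC : Monotone C) (hCH : ∀ j, C j ≤ H) :
    ∃ H', H' ⋖ H ∧ ∀ j, C j = H ∨ C j ≤ H' := by
  classical
  have : ∃ M, M < H ∧ ∀ j, C j = H ∨ C j ≤ M := by
    by_cases hne : (Finset.univ.filter (fun j => C j ≠ H)).Nonempty
    · obtain ⟨j0, hj0, hmax⟩ := Finset.exists_max_image _ id hne
      simp only [Finset.mem_filter, Finset.mem_univ, true_and, id] at hj0 hmax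
      refine ⟨C j0, lt_of_le_of_ne (hCH j0) hj0, fun j => ?_⟩
      by_cases h : C j = H
      · exact Or.inl h
      · exact Or.inr (hC (hmax j h))
    · refine ⟨⊥, bot_lt_iff_ne_bot.2 hH, fun j => Or.inl ?_⟩
      by_contra h
      exact hne ⟨j, by simpa using h⟩
  obtain ⟨M, hM, hMC⟩ := this
  obtain ⟨H', h1, h2⟩ := exists_le_covBy_of_lt hM
  exact ⟨H', h2, fun j => (hMC j).imp id (fun h => h.trans h1)⟩

theorem key {ℓ : ℕ} [FiniteDimensional K V] (H : Submodule K V) :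
    ∀ (A B : Submodule K V) (C : Fin ℓ → Submodule K V), A ≤ H → B ≤ H → Monotone C →
      (∀ j, C j ≤ H) → ∃ (ι : Type) (_ : Fintype ι) (e : ι → V) (p : ι → ι), Good H A B C e p := by
  induction H using WellFoundedLT.induction with
  | _ H ih =>
  intro A B C hA hB hC hCH
  by_cases hH : H = ⊥
  · subst hH
    refine ⟨Empty, inferInstance, fun x => x.elim, id, ?_, ?_, ?_, ?_, ?_, ?_⟩
    · exact linearIndependent_empty_type
    · simp
    · exact hA.trans bot_le
    · exact hB.trans bot_le
    · exact fun j => (hCH j).trans bot_le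
    · exact fun i => i.elim
  obtain ⟨H', hcov, hCH'⟩ := exists_hyper H hH C hC hCH
  obtain ⟨ι, hι, e, p, G⟩ := ih H' hcov.lt (A ⊓ H') (B ⊓ H') (fun j => C j ⊓ H') inf_le_right
    inf_le_right (fun i j h => inf_le_inf_right _ (hC h)) (fun j => inf_le_right)
  have easy : ∀ x, x ∉ H' → x ∈ H → (A ≤ H' ∨ x ∈ A) → (B ≤ H' ∨ x ∈ B) →
      ∃ (ι : Type) (_ : Fintype ι) (e : ι → V) (p : ι → ι), Good H A B C e p := by
    intro x hx hxH hAx hBx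
    exact ⟨Option ι, inferInstance, _, _, ext G hcov hx hxH hA hB hCH' hBx none
      (hAx.imp id fun h => ⟨x, h, hx, Or.inl rfl⟩) (by simp)⟩
  by_cases hAH : A ≤ H'
  · by_cases hBH : B ≤ H'
    · obtain ⟨x, hxH, hx⟩ := SetLike.exists_of_lt hcov.lt
      exact easy x hx hxH (Or.inl hAH) (Or.inl hBH)
    · obtain ⟨x, hxB, hx⟩ := SetLike.not_le_iff_exists.1 hBH
      exact easy x hx (hB hxB) (Or.inl hAH) (Or.inr hxB)
  by_cases hBH : B ≤ H'
  · obtain ⟨x, hxA, hx⟩ := SetLike.not_le_iff_exists.1 hAH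
    exact easy x hx (hA hxA) (Or.inr hxA) (Or.inl hBH)
  obtain ⟨a, haA, haH⟩ := SetLike.not_le_iff_exists.1 hAH
  obtain ⟨b0, hb0B, hb0H⟩ := SetLike.not_le_iff_exists.1 hBH
  obtain ⟨h, hh, b, hb, hab⟩ := mem_sup.1 (cov_decomp hcov hb0H (hB hb0B) le_rfl (hA haA))
  have hbB : b ∈ B := (span_le (p := B)).2 (by simpa using hb0B) hb
  have hhH : h ∈ span K (Set.range e) := by rw [G.sp]; exact hh.2
  obtain ⟨s, hs⟩ := (Finsupp.mem_span_range_iff_exists_finsupp).1 hhH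
  change Finsupp.linearCombination K e s = h at hs
  classical
  let P : ι → Prop := fun i => e i ∈ (A ⊓ H') ⊔ (B ⊓ H')
  set s1 := s.filter P with hs1
  set s2 := s.filter (fun i => ¬ P i) with hs2
  have hs12 : Finsupp.linearCombination K e s1 + Finsupp.linearCombination K e s2 = h := by
    rw [← map_add, hs1, hs2, Finsupp.filter_add_filter_not, hs]
  have hs1m : Finsupp.linearCombination K e s1 ∈ (A ⊓ H') ⊔ (B ⊓ H') := by
    rw [Finsupp.linearCombination_apply]
    refine sum_mem fun k hk => smul_mem _ _ ?_
    have : P k ∧ s k ≠ 0 := by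
      rw [hs1, Finsupp.support_filter] at hk
      simpa [and_comm] using hk
    exact this.1
  obtain ⟨a', ha', b', hb', hab'⟩ := mem_sup.1 hs1m
  have ha1A : a - a' ∈ A := sub_mem haA ha'.1
  have ha1H : a - a' ∉ H' := fun hc => haH (by simpa using add_mem hc ha'.2)
  have hb1B : b + b' ∈ B := add_mem hbB hb'.1
  have hab1 : a - a' = Finsupp.linearCombination K e s2 + (b + b') := by
    rw [← hab, ← hs12, ← hab']; abel
  by_cases hs0 : s2 = 0
  · rw [hs0, map_zero, zero_add] at hab1
    exact easy (a - a') ha1H (hA ha1A) (Or.inr ha1A) (Or.inr (hab1 ▸ hb1B))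
  have hs2H : Finsupp.linearCombination K e s2 ∈ H' := by
    rw [← G.sp]
    exact (Finsupp.mem_span_range_iff_exists_finsupp).2 ⟨s2, rfl⟩
  have hb1H : b + b' ∉ H' := fun hc => ha1H (by rw [hab1]; exact add_mem hs2H hc)
  obtain ⟨i0, hi0, hlast⟩ := exists_last (fun j => C j ⊓ H')
    (fun i j h => inf_le_inf_right _ (hC h)) e s2 hs0
  have hP0 : e i0 ∉ (A ⊓ H') ⊔ (B ⊓ H') := by
    intro hcon
    apply hi0
    rw [hs2, Finsupp.filter_apply_neg]
    exact not_not.2 hcon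
  obtain ⟨e', G', he'⟩ := swap G s2 i0 hi0 hP0 hlast
  refine ⟨Option ι, inferInstance, _, _, ext G' hcov hb1H (hB hb1B) hA hB hCH' (Or.inr hb1B)
    (some (p i0)) (Or.inr ⟨a - a', ha1A, ha1H, Or.inr ⟨i0, rfl, by rw [hab1, he']⟩⟩) ?_⟩
  intro k hk
  have hk0 : k = i0 := by
    by_contra hne
    exact hP0 (G.p1 i0 k (Ne.symm hne) (by simpa using hk)).1
  subst hk0
  refine ⟨⟨mem_sup_right hb1B, ?_⟩, ⟨fun _ hcon => ?_, fun _ => hb1B⟩⟩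
  · have : e' k = (a - a') - (b + b') := by rw [hab1, he']; abel
    rw [this]
    exact sub_mem (mem_sup_left ha1A) (mem_sup_right hb1B)
  · rw [he'] at hcon
    exact hP0 (mem_sup_right (coordMem G.li G.hB ⟨hcon, hs2H⟩ hi0))

def sv {ι : Type} [Fintype ι] (e : ι → V) (ε : ι → SignType) : V := ∑ i, ((ε i : SignType) : K) • e i

def Nice (K : Type*) [Field K] {V : Type*} [AddCommGroup V] [Module K V]
    {ι : Type} [Fintype ι] (e : ι → V) (U : Submodule K V) : Prop :=
  U ≤ span K {v | v ∈ U ∧ ∃ ε, v = sv (K := K) e ε}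

lemma sv_two {ι : Type} [Fintype ι] (e : ι → V) {i k : ι} (hik : i ≠ k) (α β : SignType) :
    ∃ ε, (α : K) • e i + (β : K) • e k = sv (K := K) e ε := by
  classical
  refine ⟨fun j => if j = i then α else if j = k then β else 0, ?_⟩
  have : ∀ j, (((if j = i then α else if j = k then β else 0 : SignType)) : K) • e j =
      (if j = i then (α : K) • e i else 0) + (if j = k then (β : K) • e k else 0) := by
    intro j
    by_cases h1 : j = i
    · subst h1; simp [hik]
    · by_cases h2 : j = k
      · subst h2; simp [h1]
      · simp [h1, h2]
  simp only [sv, this, Finset.sum_add_distrib, Finset.sum_ite_eq', Finset.mem_univ, if_true]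

lemma sv_one {ι : Type} [Fintype ι] (e : ι → V) (i : ι) : ∃ ε, e i = sv (K := K) e ε := by
  classical
  refine ⟨fun j => if j = i then 1 else 0, ?_⟩
  have : ∀ j, (((if j = i then 1 else 0 : SignType)) : K) • e j =
      (if j = i then e i else 0) := by
    intro j
    by_cases h1 : j = i
    · subst h1; simp
    · simp [h1]
  simp only [sv, this, Finset.sum_ite_eq', Finset.mem_univ, if_true]

lemma nice_of_coord {ι : Type} [Fintype ι] {e : ι → V} {U : Submodule K V}
    (h : U ≤ span K {v | v ∈ U ∧ ∃ i, v = e i}) : Nice K e U := by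
  refine h.trans (span_mono ?_)
  rintro v ⟨hv, i, rfl⟩
  exact ⟨hv, sv_one e i⟩

lemma rescale {ℓ : ℕ} {ι : Type} [Fintype ι] {A B : Submodule K V} {C : Fin ℓ → Submodule K V}
    {e : ι → V} {p : ι → ι} (G : Good ⊤ A B C e p) (S : Set ι) (hS : Set.InjOn p S) (c : ι → K) :
    ∃ e' : ι → V, LinearIndependent K e' ∧ ⊤ ≤ span K (Set.range e') ∧ Nice K e' A ∧
      (B ≤ span K {v | v ∈ B ∧ ∃ i, v = e' i}) ∧ (∀ j, Nice K e' (C j)) ∧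
      (∀ i, ∃ t : K, t ≠ 0 ∧ e' i = t • e i) ∧ ∀ i ∈ S, c i ≠ 0 → e' i = c i • e i := by
  classical
  have : ∃ τ : ι → Kˣ, ∀ i ∈ S, c i ≠ 0 → (τ (p i) : K) = c i := by
    refine ⟨fun q => if h : ∃ i ∈ S, c i ≠ 0 ∧ p i = q then Units.mk0 (c h.choose) h.choose_spec.2.1
      else 1, ?_⟩
    intro i hi hci
    have h : ∃ i' ∈ S, c i' ≠ 0 ∧ p i' = p i := ⟨i, hi, hci, rfl⟩
    beta_reduce
    rw [dif_pos h]
    have := hS h.choose_spec.1 hi h.choose_spec.2.2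
    simp [this]
  obtain ⟨τ, hτ⟩ := this
  let e' : ι → V := fun i => τ (p i) • e i
  have hee : ∀ i, e i = ((τ (p i))⁻¹ : Kˣ) • e' i := fun i => by simp [e']
  have hmem : ∀ (W : Submodule K V) i, e i ∈ W → e' i ∈ W := fun W i h => W.smul_mem _ h
  have hcoord : ∀ W : Submodule K V, W ≤ span K {v | v ∈ W ∧ ∃ i, v = e i} →
      W ≤ span K {v | v ∈ W ∧ ∃ i, v = e' i} := by
    intro W hW
    refine hW.trans (span_le.2 ?_)
    rintro v ⟨hv, i, rfl⟩
    have : e' i ∈ span K {v | v ∈ W ∧ ∃ i, v = e' i} := subset_span ⟨hmem W i hv, i, rfl⟩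
    show e i ∈ _
    rw [hee i]
    exact smul_mem _ _ this
  refine ⟨e', ?_, ?_, ?_, hcoord B G.hB, fun j => nice_of_coord (hcoord _ (G.hC j)), ?_, ?_⟩
  · exact G.li.units_smul (fun i => τ (p i))
  · rw [← G.sp, span_le]
    rintro _ ⟨i, rfl⟩
    have : e' i ∈ span K (Set.range e') := subset_span ⟨i, rfl⟩
    show e i ∈ _
    rw [hee i]
    exact smul_mem _ _ this
  · refine G.hA.trans (span_le.2 ?_)
    rintro v ⟨hv, ⟨i, rfl⟩ | ⟨i, k, hik, hp, rfl⟩⟩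
    · have : e' i ∈ span K {v | v ∈ A ∧ ∃ ε, v = sv (K := K) e' ε} :=
        subset_span ⟨hmem A i hv, sv_one e' i⟩
      show e i ∈ _
      rw [hee i]
      exact smul_mem _ _ this
    · have h1 : e i + e k = ((τ (p i))⁻¹ : Kˣ) • (e' i + e' k) := by
        simp [e', hp]
      have h2 : e' i + e' k ∈ A := by
        have : e' i + e' k = (τ (p i) : K) • (e i + e k) := by
          simp only [e', hp, smul_add]; rfl
        rw [this]; exact A.smul_mem _ hv
      have h3 : ∃ ε, e' i + e' k = sv (K := K) e' ε := by
        simpa using sv_two (K := K) e' hik 1 1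
      show e i + e k ∈ _
      rw [h1]
      exact smul_mem _ _ (subset_span ⟨h2, h3⟩)
  · exact fun i => ⟨τ (p i), (τ (p i)).ne_zero, rfl⟩
  · intro i hi hci
    rw [← hτ i hi hci]; rfl

lemma nice_ker {ι : Type} [Fintype ι] {e : ι → V} {W : Submodule K V}
    (hW : W ≤ span K {v | v ∈ W ∧ ∃ i, v = e i}) (φ : V →ₗ[K] K)
    (hφ : ∀ i, e i ∈ W → φ (e i) = 0 ∨ φ (e i) = 1) : Nice K e (W ⊓ LinearMap.ker φ) := by
  by_cases h0 : ∃ i0, e i0 ∈ W ∧ φ (e i0) = 1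
  · obtain ⟨i0, hi0, h1⟩ := h0
    -- the projection `w ↦ w - φ w • e i0`
    let f : V →ₗ[K] V := LinearMap.id - φ.smulRight (e i0)
    have hf : ∀ w, f w = w - φ w • e i0 := fun w => by simp [f]
    have key : W ≤ (span K {v | v ∈ W ⊓ LinearMap.ker φ ∧ ∃ ε, v = sv (K := K) e ε}).comap f := by
      refine hW.trans (span_le.2 ?_)
      rintro v ⟨hv, i, rfl⟩
      show f (e i) ∈ span K {v | v ∈ W ⊓ LinearMap.ker φ ∧ ∃ ε, v = sv (K := K) e ε}
      have hm : f (e i) ∈ W ⊓ LinearMap.ker φ := by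
        rw [hf]
        refine ⟨sub_mem hv (smul_mem _ _ hi0), ?_⟩
        simp [h1]
      by_cases hi : i = i0
      · subst hi
        have : f (e i) = 0 := by rw [hf, h1]; simp
        rw [this]; exact zero_mem _
      refine subset_span ⟨hm, ?_⟩
      rw [hf]
      rcases hφ i hv with h | h
      · rw [h]; simpa using sv_one (K := K) e i
      · rw [h]; simpa [sub_eq_add_neg] using sv_two (K := K) e hi 1 (-1)
    rintro w ⟨hw, hk⟩
    have := key hw
    have hk : φ w = 0 := hk
    rw [mem_comap, hf, hk] at this
    simpa using this
  · have : W ≤ LinearMap.ker φ := by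
      refine hW.trans (span_le.2 ?_)
      rintro v ⟨hv, i, rfl⟩
      rcases hφ i hv with h | h
      · exact h
      · exact absurd ⟨i, hv, h⟩ h0
    rw [inf_eq_left.2 this]
    exact nice_of_coord hW

lemma nice_line {ι : Type} [Fintype ι] {e e' : ι → V} (s : ι → K)
    (h : ∀ i, s i ≠ 0 → e' i = s i • e i) : Nice K e' (span K {∑ i, s i • e i}) := by
  classical
  refine span_mono ?_
  rintro v rfl
  refine ⟨mem_span_singleton_self _, fun i => if s i = 0 then 0 else 1, ?_⟩
  refine Finset.sum_congr rfl fun i _ => ?_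
  by_cases hi : s i = 0
  · simp [hi]
  · simp [hi, h i hi]

lemma exists_ker [FiniteDimensional K V] {U W : Submodule K V} (h : U ≤ W)
    (hd : finrank K W = finrank K U + 1) : ∃ φ : V →ₗ[K] K, U = W ⊓ LinearMap.ker φ := by
  have hlt : U < W := lt_of_le_of_ne h (by rintro rfl; omega)
  obtain ⟨x, hxW, hxU⟩ := SetLike.exists_of_lt hlt
  obtain ⟨φ, h1, h2⟩ := Submodule.exists_le_ker_of_notMem hxU
  refine ⟨φ, eq_of_le_of_finrank_le (le_inf h h2) ?_⟩
  have : W ⊓ LinearMap.ker φ < W := by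
    refine lt_of_le_of_ne inf_le_left fun hc => h1 ?_
    rw [← hc] at hxW
    exact hxW.2
  have := finrank_lt_finrank_of_lt this
  omega

theorem normal {ℓ : ℕ} [FiniteDimensional K V] (A B1 B2 : Submodule K V) (C : Fin ℓ → Submodule K V)
    (hC : Monotone C) (h12 : B1 ≤ B2)
    (hb : finrank K B1 = 1 ∨ finrank K B2 = finrank K B1 + 1 ∨ finrank K V = finrank K B2 + 1) :
    ∃ (ι : Type) (_ : Fintype ι) (e : Basis ι K V), Nice K e A ∧ Nice K e B1 ∧ Nice K e B2 ∧
      ∀ j, Nice K e (C j) := by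
  have fin : ∀ (ι : Type) (_ : Fintype ι) (e : ι → V), LinearIndependent K e →
      ⊤ ≤ span K (Set.range e) → Nice K e A → Nice K e B1 → Nice K e B2 → (∀ j, Nice K e (C j)) →
      ∃ (ι : Type) (_ : Fintype ι) (e : Basis ι K V), Nice K e A ∧ Nice K e B1 ∧ Nice K e B2 ∧
      ∀ j, Nice K e (C j) := by
    intro ι hι e h1 h2 h3 h4 h5 h6
    refine ⟨ι, hι, Basis.mk h1 h2, ?_⟩
    rw [Basis.coe_mk]
    exact ⟨h3, h4, h5, h6⟩
  rcases hb with hb | hb | hb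
  · obtain ⟨ι, hι, e, p, G⟩ := key ⊤ A B2 C le_top le_top hC (fun _ => le_top)
    obtain ⟨v, hv⟩ : ∃ v, B1 = span K {v} := by
      obtain ⟨v, -, hv⟩ := finrank_eq_one_iff'.1 hb
      refine ⟨v, le_antisymm ?_ (by simp [span_le])⟩
      intro w hw
      obtain ⟨c, hc⟩ := hv ⟨w, hw⟩
      exact mem_span_singleton.2 ⟨c, congrArg Subtype.val hc⟩
    have hvB : v ∈ B2 := h12 (hv ▸ mem_span_singleton_self v)
    have hvt : v ∈ span K (Set.range e) := by rw [G.sp]; trivial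
    obtain ⟨s, hs⟩ := (Finsupp.mem_span_range_iff_exists_finsupp).1 hvt
    have hsB : ∀ i, s i ≠ 0 → e i ∈ B2 := fun i hi => coordMem G.li G.hB
      (s := s) (by rw [Finsupp.linearCombination_apply, hs]; exact hvB) hi
    obtain ⟨e', h1, h2, h3, h4, h5, h6, h7⟩ := rescale G {i | e i ∈ B2} (by
      intro i hi k hk hp
      by_contra hne
      exact (G.p1 i k hne hp).2.1 hi hk) s
    refine fin ι hι e' h1 h2 h3 ?_ (nice_of_coord h4) h5
    rw [hv, ← hs, Finsupp.sum_fintype _ _ (by simp)]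
    exact nice_line s fun i hi => h7 i (hsB i hi) hi
  · obtain ⟨ι, hι, e, p, G⟩ := key ⊤ A B2 C le_top le_top hC (fun _ => le_top)
    obtain ⟨φ, hφ⟩ := exists_ker h12 hb
    obtain ⟨e', h1, h2, h3, h4, h5, h6, h7⟩ := rescale G {i | e i ∈ B2} (by
      intro i hi k hk hp
      by_contra hne
      exact (G.p1 i k hne hp).2.1 hi hk) (fun i => (φ (e i))⁻¹)
    refine fin ι hι e' h1 h2 h3 ?_ (nice_of_coord h4) h5
    rw [hφ]
    refine nice_ker h4 φ fun i hi => ?_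
    obtain ⟨t, ht, hte⟩ := h6 i
    by_cases h0 : φ (e i) = 0
    · left; rw [hte, map_smul, h0, smul_zero]
    · right
      have hi' : e i ∈ B2 := by
        rw [hte] at hi
        exact (B2.smul_mem_iff ht).1 hi
      rw [h7 i hi' (inv_ne_zero h0), map_smul, smul_eq_mul, inv_mul_cancel₀ h0]
  · obtain ⟨ι, hι, e, p, G⟩ := key ⊤ A B1 C le_top le_top hC (fun _ => le_top)
    obtain ⟨φ, hφ⟩ := exists_ker (le_top : B2 ≤ ⊤) (by rw [finrank_top]; exact hb)
    obtain ⟨e', h1, h2, h3, h4, h5, h6, h7⟩ := rescale G {i | e i ∉ B1} (by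
      intro i hi k hk hp
      by_contra hne
      exact hi ((G.p1 i k hne hp).2.2 hk)) (fun i => (φ (e i))⁻¹)
    refine fin ι hι e' h1 h2 h3 (nice_of_coord h4) ?_ h5
    rw [hφ]
    refine nice_ker (h2.trans (span_mono ?_)) φ fun i hi => ?_
    · rintro _ ⟨i, rfl⟩
      exact ⟨trivial, i, rfl⟩
    obtain ⟨t, ht, hte⟩ := h6 i
    by_cases h0 : φ (e i) = 0
    · left; rw [hte, map_smul, h0, smul_zero]
    · right
      have hi' : e i ∉ B1 := by
        intro hc
        have := h12 hc
        rw [hφ] at this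
        exact h0 this.2
      rw [h7 i hi' (inv_ne_zero h0), map_smul, smul_eq_mul, inv_mul_cancel₀ h0]

lemma nice_reindex {ι κ : Type} [Fintype ι] [Fintype κ] (f : ι ≃ κ) (e : Basis ι K V)
    {U : Submodule K V} (h : Nice K e U) : Nice K (e.reindex f) U := by
  refine h.trans (span_mono ?_)
  rintro v ⟨hv, ε, rfl⟩
  refine ⟨hv, ε ∘ f.symm, ?_⟩
  unfold sv
  exact Fintype.sum_equiv f _ _ (by simp)

lemma nice_eq {ι : Type} [Fintype ι] {e : ι → V} {U : Submodule K V} (h : Nice K e U) :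
    U = span K (sv (K := K) e '' {ε | sv (K := K) e ε ∈ U}) := by
  apply le_antisymm
  · refine h.trans (span_mono ?_)
    rintro v ⟨hv, ε, rfl⟩
    exact ⟨ε, hv, rfl⟩
  · rw [span_le]
    rintro _ ⟨ε, hε, rfl⟩
    exact hε

lemma map_sv {ι : Type} [Fintype ι] (e : ι → V) (g : V →ₗ[K] V) (d : Set (ι → SignType)) :
    (span K (sv (K := K) e '' d)).map g = span K (sv (K := K) (fun i => g (e i)) '' d) := by
  rw [Submodule.map_span, Set.image_image]
  congr 1
  refine Set.image_congr fun ε _ => ?_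
  simp [sv]

end OrbAux

/-- GL(V) has finitely many orbits on configurations `(A, B₁ ⊆ B₂, C₁ ⊆ ⋯ ⊆ C_ℓ)`
for arbitrary `ℓ ≥ 1`, provided `min(b₁, b₂-b₁, n-b₂) = 1`. -/
theorem finitely_many_orbits_one_two_ell_b_width_one
    (K : Type*) [Field K] [IsAlgClosed K] (V : Type*) [AddCommGroup V] [Module K V]
    [FiniteDimensional K V] (n ℓ a b1 b2 : ℕ) (hn : finrank K V = n)
    (hl1 : 1 ≤ ℓ) (hbw : min b1 (min (b2 - b1) (n - b2)) = 1)
    (c : Fin ℓ → ℕ) (hc : StrictMono c)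
    (ha0 : 0 < a) (han : a < n)
    (hb10 : 0 < b1) (hb12 : b1 < b2) (hb2n : b2 < n)
    (hc0 : ∀ j, 0 < c j) (hcn : ∀ j, c j < n) :
    { O : Set (Submodule K V × (Submodule K V × Submodule K V) × (Fin ℓ → Submodule K V)) |
        ∃ x : Submodule K V × (Submodule K V × Submodule K V) × (Fin ℓ → Submodule K V),
          (finrank K x.1 = a ∧
            x.2.1.1 ≤ x.2.1.2 ∧ finrank K x.2.1.1 = b1 ∧ finrank K x.2.1.2 = b2 ∧
            Monotone x.2.2 ∧ (∀ j, finrank K (x.2.2 j) = c j)) ∧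
          O = { x' | ∃ g : V ≃ₗ[K] V,
            x.1.map g.toLinearMap = x'.1 ∧
            x.2.1.1.map g.toLinearMap = x'.2.1.1 ∧
            x.2.1.2.map g.toLinearMap = x'.2.1.2 ∧
            ∀ j, (x.2.2 j).map g.toLinearMap = x'.2.2 j } }.Finite := by
    classical
  let E := Fin n → SignType
  let R : Basis (Fin n) K V → Set E → Submodule K V := fun e d =>
    Submodule.span K (OrbAux.sv (K := K) e '' d)
  have hR : ∀ (e : Basis (Fin n) K V) (g : V ≃ₗ[K] V) d,
      (R e d).map g.toLinearMap = R (e.map g) d := by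
    intro e g d
    simp only [R]
    rw [OrbAux.map_sv]
    congr 2
  let F : Set E × (Set E × Set E) × (Fin ℓ → Set E) →
      Set (Submodule K V × (Submodule K V × Submodule K V) × (Fin ℓ → Submodule K V)) := fun d =>
    {x' | ∃ e : Basis (Fin n) K V, R e d.1 = x'.1 ∧ R e d.2.1.1 = x'.2.1.1 ∧
      R e d.2.1.2 = x'.2.1.2 ∧ ∀ j, R e (d.2.2 j) = x'.2.2 j}
  refine (Set.finite_range F).subset ?_
  rintro O ⟨⟨A, ⟨B1, B2⟩, C⟩, ⟨h1, h2, h3, h4, h5, h6⟩, rfl⟩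
  dsimp only at h1 h2 h3 h4 h5 h6
  obtain ⟨ι, hι, e0, hA, hB1, hB2, hC⟩ := OrbAux.normal A B1 B2 C h5 h2 (by omega)
  have hcard : Fintype.card ι = n := by rw [← hn, finrank_eq_card_basis e0]
  let f : ι ≃ Fin n := Fintype.equivFinOfCardEq hcard
  let e := e0.reindex f
  have hA' := OrbAux.nice_eq (OrbAux.nice_reindex f e0 hA)
  have hB1' := OrbAux.nice_eq (OrbAux.nice_reindex f e0 hB1)
  have hB2' := OrbAux.nice_eq (OrbAux.nice_reindex f e0 hB2)
  have hC' := fun j => OrbAux.nice_eq (OrbAux.nice_reindex f e0 (hC j))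
  obtain ⟨dA, hdA⟩ : ∃ d, A = R e d := ⟨_, hA'⟩
  obtain ⟨dB1, hdB1⟩ : ∃ d, B1 = R e d := ⟨_, hB1'⟩
  obtain ⟨dB2, hdB2⟩ : ∃ d, B2 = R e d := ⟨_, hB2'⟩
  obtain ⟨dC, hdC⟩ : ∃ d : Fin ℓ → Set E, ∀ j, C j = R e (d j) := ⟨_, hC'⟩
  refine ⟨(dA, (dB1, dB2), dC), ?_⟩
  ext ⟨A', ⟨B1', B2'⟩, C'⟩
  simp only [F, Set.mem_ofPred_eq, hdA, hdB1, hdB2, hdC, hR]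
  constructor
  · rintro ⟨e', h⟩
    refine ⟨e.equiv e' (Equiv.refl _), ?_⟩
    have : e.map (e.equiv e' (Equiv.refl _)) = e' := by
      ext i; simp
    rw [this]
    exact h
  · rintro ⟨g, h⟩
    exact ⟨e.map g, h⟩
end
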